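/- Let n be a natural number, C₁ a subset of Fin n with complement C₂, and let π, γ₁ be permutations of Fin n such that π ∘ π = id, π maps C₁ onto C₂, and γ₁ fixes every element of C₂ pointwise. Suppose ε is a permutation of Fin n satisfying ε(x) = π(x) for every x ∈ C₁ and ε(x) = (γ₁⁻¹ ∘ π ∘ γ₁)(x) for every x ∈ C₂. Then ε ∘ ε = A⁻¹, where A = γ₁ ∘ (π ∘ γ₁ ∘ π) is the symmetric knotting; consequently ε⁻¹ is a square root of A, i.e., (ε⁻¹)² = A. -/

import Mathlib

/-- Theorem 1 of the paper: the edge structuring knot `ε`, built from the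
fixed-point-free involution `π` (applied on `C₁`) and `δ = γ₁⁻¹ ∘ π ∘ γ₁`
(applied on `C₂`), squares to the inverse of the symmetric knotting
`A = γ₁ ∘ (π ∘ γ₁ ∘ π)`; hence `ε⁻¹` is a square root of `A`. -/
theorem knot_sq_eq_symmetric_knotting_inv
    (n : ℕ) (C₁ : Set (Fin n)) (π γ₁ ε : Equiv.Perm (Fin n))
    (hπ : π * π = 1)
    (hπC : π '' C₁ = C₁ᶜ)
    (hγ : ∀ x ∈ C₁ᶜ, γ₁ x = x)
    (hε₁ : ∀ x ∈ C₁, ε x = π x)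
    (hε₂ : ∀ x ∈ C₁ᶜ, ε x = γ₁⁻¹ (π (γ₁ x))) :
    ε * ε = (γ₁ * (π * γ₁ * π))⁻¹ ∧ (ε⁻¹) ^ 2 = γ₁ * (π * γ₁ * π) := by
  have hππ (x : Fin n) : π (π x) = x := by
    rw [← Equiv.Perm.mul_apply, hπ, Equiv.Perm.one_apply]
  have hγπ : ∀ x ∈ C₁, γ₁ (π x) = π x := fun x hx =>
    hγ _ (hπC ▸ Set.mem_image_of_mem π hx)
  have hε : ε = γ₁⁻¹ * π := by
    ext x : 1
    rw [Equiv.Perm.mul_apply, Equiv.Perm.eq_inv_iff_eq]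
    by_cases hx : x ∈ C₁
    · rw [hε₁ x hx, hγπ x hx]
    · simp [hε₂ x hx, hγ x hx]
  have hdisj : Equiv.Perm.Disjoint γ₁ (π * γ₁ * π) := fun x => by
    by_cases hx : x ∈ C₁
    · right
      simp only [Equiv.Perm.mul_apply, hγπ x hx, hππ]
    · exact Or.inl (hγ x hx)
  have hπinv : π⁻¹ = π := inv_eq_of_mul_eq_one_left hπ
  have hsq : ε * ε = (γ₁ * (π * γ₁ * π))⁻¹ := by
    rw [hdisj.commute.eq, hε]
    simp only [mul_inv_rev, hπinv, mul_assoc]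
  exact ⟨hsq, by rw [inv_pow, sq, hsq, inv_inv]⟩
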